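/- Stability of the total-variation dual value: Let S be a finite nonempty set, let p and q be pmfs on S, let v : S → ℝ with v(s) ≥ 0 for all s, and let σ ≥ 0. Then | f*_TV(q, v) − f*_TV(p, v) | ≤ max_{0 ≤ α ≤ max_{s∈S} v(s)} | E_q[(v)_α] − E_p[(v)_α] |. -/

import Mathlib

open Finset

/-- `p` is a probability mass function on the finite nonempty type `S`. -/
def IsPmf {S : Type*} [Fintype S] (p : S → ℝ) : Prop :=
  (∀ s, 0 ≤ p s) ∧ ∑ s, p s = 1

/-- The total-variation dual value with uncertainty level `σ`:
`f*_TV(p, v) = sup_{α ≥ 0} { E_p[(v)_α] − σ·(α − min_s v(s)) }`. -/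
noncomputable def fstarTV {S : Type*} [Fintype S] (σ : ℝ) (p v : S → ℝ) : ℝ :=
  sSup {x : ℝ | ∃ α : ℝ, 0 ≤ α ∧
    x = (∑ s, p s * min (v s) α) - σ * (α - ⨅ s, v s)}

/-- An expectation of a truncation of `v` at a nonnegative level lies between `0` and `max v`. -/
theorem IsPmf.sum_mul_min_mem_Icc {S : Type*} [Fintype S] {p v : S → ℝ} (hp : IsPmf p)
    (hv : ∀ s, 0 ≤ v s) {α : ℝ} (hα : 0 ≤ α) :
    ∑ s, p s * min (v s) α ∈ Set.Icc 0 (⨆ s, v s) := by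
  refine ⟨sum_nonneg fun s _ => mul_nonneg (hp.1 s) (le_min (hv s) hα), ?_⟩
  calc ∑ s, p s * min (v s) α ≤ ∑ s, p s * ⨆ s, v s :=
        sum_le_sum fun s _ => mul_le_mul_of_nonneg_left
          ((min_le_left _ _).trans (le_ciSup (Set.finite_range v).bddAbove s)) (hp.1 s)
    _ = ⨆ s, v s := by rw [← sum_mul, hp.2, one_mul]

/-- The set whose supremum is the total-variation dual value is bounded above. -/
theorem IsPmf.bddAbove_fstarTV {S : Type*} [Fintype S] {p v : S → ℝ} (hp : IsPmf p)
    (hv : ∀ s, 0 ≤ v s) {σ : ℝ} (hσ : 0 ≤ σ) :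
    BddAbove {x : ℝ | ∃ α : ℝ, 0 ≤ α ∧
      x = (∑ s, p s * min (v s) α) - σ * (α - ⨅ s, v s)} := by
  refine ⟨(⨆ s, v s) + σ * ⨅ s, v s, ?_⟩
  rintro _ ⟨α, hα, rfl⟩
  have h := (hp.sum_mul_min_mem_Icc hv hα).2
  have hσα := mul_nonneg hσ hα
  rw [mul_sub]
  linarith

/-- Truncating at `α` is the same as truncating at the smaller of `α` and `max v`. -/
theorem min_min_iSup {S : Type*} [Finite S] (v : S → ℝ) (α : ℝ) (s : S) :
    min (v s) (min α (⨆ s, v s)) = min (v s) α := by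
  rw [min_comm α, ← min_assoc, min_eq_left (le_ciSup (Set.finite_range v).bddAbove s)]

/-- A uniform bound on the differences of truncated expectations bounds the increase of the
total-variation dual value. -/
theorem fstarTV_le_add {S : Type*} [Fintype S] {p q v : S → ℝ} (hp : IsPmf p)
    (hv : ∀ s, 0 ≤ v s) {σ D : ℝ} (hσ : 0 ≤ σ)
    (hD : ∀ α : ℝ, 0 ≤ α → (∑ s, q s * min (v s) α) - ∑ s, p s * min (v s) α ≤ D) :
    fstarTV σ q v ≤ fstarTV σ p v + D := by
  refine csSup_le ⟨_, 0, le_rfl, rfl⟩ ?_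
  rintro _ ⟨α, hα, rfl⟩
  have h : (∑ s, p s * min (v s) α) - σ * (α - ⨅ s, v s) ≤ fstarTV σ p v :=
    le_csSup (hp.bddAbove_fstarTV hv hσ) ⟨α, hα, rfl⟩
  linarith [hD α hα]

/-- Stability of the total-variation dual value. -/
theorem fstarTV_stability
    {S : Type*} [Fintype S] [Nonempty S]
    (p q : S → ℝ) (hp : IsPmf p) (hq : IsPmf q)
    (v : S → ℝ) (hv : ∀ s, 0 ≤ v s)
    (σ : ℝ) (hσ : 0 ≤ σ) :
    |fstarTV σ q v - fstarTV σ p v| ≤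
      sSup {x : ℝ | ∃ α : ℝ, 0 ≤ α ∧ α ≤ (⨆ s, v s) ∧
        x = |(∑ s, q s * min (v s) α) - ∑ s, p s * min (v s) α|} := by
  set D := sSup {x : ℝ | ∃ α : ℝ, 0 ≤ α ∧ α ≤ (⨆ s, v s) ∧
    x = |(∑ s, q s * min (v s) α) - ∑ s, p s * min (v s) α|}
  have hbdd : BddAbove {x : ℝ | ∃ α : ℝ, 0 ≤ α ∧ α ≤ (⨆ s, v s) ∧
      x = |(∑ s, q s * min (v s) α) - ∑ s, p s * min (v s) α|} := by
    refine ⟨⨆ s, v s, ?_⟩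
    rintro _ ⟨α, hα, -, rfl⟩
    obtain ⟨hp₀, hp₁⟩ := hp.sum_mul_min_mem_Icc hv hα
    obtain ⟨hq₀, hq₁⟩ := hq.sum_mul_min_mem_Icc hv hα
    exact abs_le.2 ⟨by linarith, by linarith⟩
  have hdiff : ∀ α : ℝ, 0 ≤ α →
      |(∑ s, q s * min (v s) α) - ∑ s, p s * min (v s) α| ≤ D := fun α hα =>
    le_csSup hbdd ⟨min α (⨆ s, v s), le_min hα (Real.iSup_nonneg hv), min_le_right _ _, by
      simp only [min_min_iSup]⟩
  have hqp := fstarTV_le_add hp hv hσ fun α hα => (abs_le.1 (hdiff α hα)).2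
  have hpq : fstarTV σ p v ≤ fstarTV σ q v + D :=
    fstarTV_le_add hq hv hσ fun α hα => by linarith [(abs_le.1 (hdiff α hα)).1]
  exact abs_le.2 ⟨by linarith, by linarith⟩
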